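/- arXiv:2207.09387 — 2 statements merged into one kernel-verified Lean document; each statement's English description precedes it below -/
import Mathlib

section
/- Let β, μ > 0 with βμ > 1, let γ ≥ βμ, and let ψ₁, ψ₂ ≥ 0. Suppose (Δ_t)_{t≥0} is a sequence of nonnegative reals satisfying Δ_0 ≤ β²ψ₂/((βμ−1)γ) + βψ₁/(βμ−1) and, for every t ≥ 0, Δ_{t+1} ≤ (1 − μβ/(t+γ)) Δ_t + (β/(t+γ))² ψ₂ + (β/(t+γ)) ψ₁. Then for every t ≥ 0 it holds that Δ_t ≤ β²ψ₂/((βμ−1)(t+γ)) + βψ₁/(βμ−1). -/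
/-- induction lemma converting the per-iteration recursion with decaying
learning rate `η_t = β/(t+γ)` into the convergence-rate bound
`Δ_t ≤ β²ψ₂/((βμ−1)(t+γ)) + βψ₁/(βμ−1)`. -/
theorem sgd_recursion_induction
    (β μ γ ψ1 ψ2 : ℝ) (hβ : 0 < β) (hμ : 0 < μ) (hβμ : 1 < β * μ)
    (hγ : β * μ ≤ γ) (hψ1 : 0 ≤ ψ1) (hψ2 : 0 ≤ ψ2)
    (Δ : ℕ → ℝ) (hΔ : ∀ t, 0 ≤ Δ t)
    (h0 : Δ 0 ≤ β ^ 2 * ψ2 / ((β * μ - 1) * γ) + β * ψ1 / (β * μ - 1))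
    (hrec : ∀ t : ℕ, Δ (t + 1)
        ≤ (1 - μ * β / ((t : ℝ) + γ)) * Δ t + (β / ((t : ℝ) + γ)) ^ 2 * ψ2
          + (β / ((t : ℝ) + γ)) * ψ1) :
    ∀ t : ℕ, Δ t ≤ β ^ 2 * ψ2 / ((β * μ - 1) * ((t : ℝ) + γ)) + β * ψ1 / (β * μ - 1) := by
  have ha : 0 < β * μ - 1 := by linarith
  intro t
  induction t with
  | zero => simpa using h0
  | succ t ih =>
    push_cast
    have hs : β * μ ≤ (t : ℝ) + γ := by linarith [t.cast_nonneg (α := ℝ)]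
    have hstep := hrec t
    rw [show (t : ℝ) + 1 + γ = (t + γ) + 1 by ring]
    generalize (t : ℝ) + γ = s at *
    have hs0 : 0 < s := by linarith
    have hcontr : 0 ≤ 1 - μ * β / s := by
      rw [sub_nonneg, div_le_one hs0]
      linarith
    have hdecay : (s - 1) / s ^ 2 ≤ 1 / (s + 1) := by
      rw [div_le_div_iff₀ (by positivity) (by positivity)]
      nlinarith
    calc Δ (t + 1)
        ≤ (1 - μ * β / s) * Δ t + (β / s) ^ 2 * ψ2 + β / s * ψ1 := hstep
      _ ≤ (1 - μ * β / s) * (β ^ 2 * ψ2 / ((β * μ - 1) * s) + β * ψ1 / (β * μ - 1))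
          + (β / s) ^ 2 * ψ2 + β / s * ψ1 := by gcongr
      _ = β ^ 2 * ψ2 / (β * μ - 1) * ((s - 1) / s ^ 2) + β * ψ1 / (β * μ - 1)
          - β * ψ1 / (β * μ - 1) / s := by
        rw [show μ * β = (β * μ - 1) + 1 by ring]
        generalize β * μ - 1 = a at ha
        field_simp
        ring
      _ ≤ β ^ 2 * ψ2 / (β * μ - 1) * (1 / (s + 1)) + β * ψ1 / (β * μ - 1) := by
        have hD : 0 ≤ β * ψ1 / (β * μ - 1) / s := by positivity
        have hC : 0 ≤ β ^ 2 * ψ2 / (β * μ - 1) := by positivity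
        linarith [mul_le_mul_of_nonneg_left hdecay hC]
      _ = β ^ 2 * ψ2 / ((β * μ - 1) * (s + 1)) + β * ψ1 / (β * μ - 1) := by
        rw [div_mul_div_comm, mul_one]
end

section
/- Let all constants be positive with βμ > 1, D > 0, K > 0, G > 0, and suppose γ < (β²/((βμ−1)D))·(S + 4G² + 4LΓ). Define g₂(I) = β²ψ₂(I)/(I(βμ−1)D) − γ/I for I > 0. Then g₂ attains its global minimum over (0, ∞) at I'' = √( (S + 4G² + 4LΓ − γ(βμ−1)D/β²) / (4G² + 4G²/K) ), i.e. g₂(I) ≥ g₂(I'') for all I > 0. -/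
/-- The convex function `x ↦ A x + B / x` on `(0, ∞)` is minimized at `x₀` with `A x₀² = B`. -/
theorem mul_add_div_min_of_mul_sq_eq {A B x₀ x : ℝ} (hA : 0 ≤ A) (hx : 0 < x)
    (h : A * x₀ ^ 2 = B) : A * x₀ + B / x₀ ≤ A * x + B / x := by
  subst h
  have key : A * x + A * x₀ ^ 2 / x - (A * x₀ + A * x₀ ^ 2 / x₀) = A * (x - x₀) ^ 2 / x := by
    field_simp
    ring
  have : 0 ≤ A * (x - x₀) ^ 2 / x := by positivity
  linarith

/-- Lemma 4 of the paper: the number of communication rounds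
`g₂(I) = β²ψ₂(I)/(I(βμ−1)D) − γ/I` attains its global minimum over `(0, ∞)` at
`I'' = √((S + 4G² + 4LΓ − γ(βμ−1)D/β²)/(4G² + 4G²/K))`. -/
theorem g2_min_at_I
    (S Γ L G dd K β μ γ ε ρ m n : ℝ)
    (hS : 0 ≤ S) (hΓ : 0 ≤ Γ) (hL : 0 < L) (hG : 0 < G) (hdd : 0 < dd)
    (hK : 0 < K) (hβ : 0 < β) (hμ : 0 < μ) (hγ : 0 < γ) (hm : 0 < m)
    (hβμ : 1 < β * μ)
    (ψ1 : ℝ) (hψ1 : ψ1 = dd * (ρ - μ) / (2 : ℝ) ^ (2 * n))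
    (D : ℝ) (hDdef : D = 2 * ε / L - β * ψ1 / (β * μ - 1)) (hD : 0 < D)
    (hγlt : γ < β ^ 2 / ((β * μ - 1) * D) * (S + 4 * G ^ 2 + 4 * L * Γ))
    (ψ2 : ℝ → ℝ)
    (hψ2 : ∀ I, ψ2 I = S + 4 * (I - 1) ^ 2 * G ^ 2
        + 4 * dd * I * G ^ 2 / (K * (2 : ℝ) ^ (2 * m)) + 4 * I ^ 2 * G ^ 2 / K
        + 4 * L * Γ)
    (g2 : ℝ → ℝ) (hg2 : ∀ I, g2 I = β ^ 2 * ψ2 I / (I * (β * μ - 1) * D) - γ / I)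
    (I'' : ℝ)
    (hI'' : I'' = Real.sqrt ((S + 4 * G ^ 2 + 4 * L * Γ - γ * (β * μ - 1) * D / β ^ 2)
        / (4 * G ^ 2 + 4 * G ^ 2 / K))) :
    ∀ I, 0 < I → g2 I'' ≤ g2 I := by
  intro I hI
  have hb : 0 < β * μ - 1 := by linarith
  set A := 4 * G ^ 2 + 4 * G ^ 2 / K with hAdef
  set B := S + 4 * G ^ 2 + 4 * L * Γ - γ * (β * μ - 1) * D / β ^ 2 with hBdef
  have hA : 0 < A := by positivity
  have hB : 0 < B := by
    rw [div_mul_eq_mul_div, lt_div_iff₀ (by positivity)] at hγlt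
    rw [hBdef, sub_pos, div_lt_iff₀ (by positivity)]
    linarith
  have hI''pos : 0 < I'' := hI'' ▸ Real.sqrt_pos.2 (div_pos hB hA)
  have hsq : A * I'' ^ 2 = B := by
    rw [hI'', Real.sq_sqrt (div_pos hB hA).le, mul_div_cancel₀ _ hA.ne']
  have hP : (0 : ℝ) < 2 ^ (2 * m) := by positivity
  have hform : ∀ x, 0 < x → g2 x = β ^ 2 / ((β * μ - 1) * D) *
      (A * x + B / x + (4 * dd * G ^ 2 / (K * 2 ^ (2 * m)) - 8 * G ^ 2)) := by
    intro x hx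
    rw [hg2, hψ2, hAdef, hBdef]
    generalize (2 : ℝ) ^ (2 * m) = P at hP ⊢
    generalize β * μ - 1 = b at hb ⊢
    field_simp
    ring
  rw [hform _ hI''pos, hform I hI]
  have := mul_add_div_min_of_mul_sq_eq hA.le hI hsq
  gcongr
end
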